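/- arXiv:2503.21018 — 2 statements merged into one kernel-verified Lean document; each statement's English description precedes it below -/
import Mathlib

section
/- Let Z and Z' be nonempty finite multisets of real numbers, all of whose elements lie in the interval [0,1], and let m = |Z|. Suppose Z' can be obtained from Z by inserting and/or removing a total of at most k elements (i.e., the multiset symmetric difference of Z and Z' has cardinality at most k). Then the averages differ by at most k/m: |(1/|Z|)·Σ_{z∈Z} z − (1/|Z'|)·Σ_{z'∈Z'} z'| ≤ k/m. -/
theorem sum_bounds_aux (A : Multiset ℝ) (h : ∀ z ∈ A, z ∈ Set.Icc (0 : ℝ) 1) :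
    0 ≤ A.sum ∧ A.sum ≤ (A.card : ℝ) := by
  induction A using Multiset.induction with
  | empty => simp
  | cons a s ih =>
    have h1 := h a (Multiset.mem_cons_self a s)
    have h2 := ih (fun z hz => h z (Multiset.mem_cons_of_mem hz))
    simp only [Multiset.sum_cons, Multiset.card_cons, Nat.cast_add, Nat.cast_one]
    exact ⟨by linarith [h1.1, h2.1], by linarith [h1.2, h2.2]⟩

/-- If the multiset symmetric difference of two nonempty multisets of
reals in `[0,1]` has cardinality at most `k`, then their averages differ by at most
`k / |Z|`. -/
theorem stmt_0 (Z Z' : Multiset ℝ) (hZ : Z ≠ 0) (hZ' : Z' ≠ 0)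
    (hZ01 : ∀ z ∈ Z, z ∈ Set.Icc (0 : ℝ) 1) (hZ'01 : ∀ z ∈ Z', z ∈ Set.Icc (0 : ℝ) 1)
    (k : ℕ) (hk : ((Z - Z') + (Z' - Z)).card ≤ k) :
    |Z.sum / (Z.card : ℝ) - Z'.sum / (Z'.card : ℝ)| ≤ (k : ℝ) / (Z.card : ℝ) := by
  have e1 : Z - Z' + Z ∩ Z' = Z := Multiset.sub_add_inter Z Z'
  have e2 : Z' - Z + Z ∩ Z' = Z' := by
    rw [Multiset.inter_comm]; exact Multiset.sub_add_inter Z' Z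
  have hA := sum_bounds_aux (Z - Z')
    (fun z hz => hZ01 z (Multiset.mem_of_le (Multiset.sub_le_self _ _) hz))
  have hB := sum_bounds_aux (Z' - Z)
    (fun z hz => hZ'01 z (Multiset.mem_of_le (Multiset.sub_le_self _ _) hz))
  have hS := sum_bounds_aux Z' hZ'01
  have hm : (0 : ℝ) < Z.card := by exact_mod_cast Multiset.card_pos.2 hZ
  have hn : (0 : ℝ) < Z'.card := by exact_mod_cast Multiset.card_pos.2 hZ'
  have s1 := congrArg Multiset.sum e1
  have s2 := congrArg Multiset.sum e2
  have c1 := congrArg (fun s : Multiset ℝ => (s.card : ℝ)) e1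
  have c2 := congrArg (fun s : Multiset ℝ => (s.card : ℝ)) e2
  have hk' : (((Z - Z').card : ℝ) + (Z' - Z).card) ≤ k := by
    rw [Multiset.card_add] at hk; exact_mod_cast hk
  simp only [Multiset.sum_add, Multiset.card_add, Nat.cast_add] at s1 s2 c1 c2
  have ha : (0 : ℝ) ≤ (Z - Z').card := Nat.cast_nonneg _
  have hb : (0 : ℝ) ≤ (Z' - Z).card := Nat.cast_nonneg _
  generalize ((Z - Z').card : ℝ) = a at *
  generalize ((Z' - Z).card : ℝ) = b at *
  generalize ((Z ∩ Z').card : ℝ) = c at *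
  generalize (Z.card : ℝ) = m at *
  generalize (Z'.card : ℝ) = n at *
  obtain ⟨t, ht⟩ : ∃ t, t = Z'.sum / n := ⟨_, rfl⟩
  have ht0 : 0 ≤ t := ht ▸ div_nonneg hS.1 hn.le
  have ht1 : t ≤ 1 := by rw [ht, div_le_one hn]; exact hS.2
  have htn : Z'.sum = t * n := by rw [ht]; field_simp
  rw [← ht]
  have e : Z.sum / m - t = (Z.sum - t * m) / m := by field_simp
  rw [e, abs_div, abs_of_pos hm]
  gcongr
  have key : Z.sum - t * m = (Z - Z').sum - (Z' - Z).sum - t * a + t * b := by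
    rw [← c2] at htn
    rw [← c1]
    linarith
  have h1 := mul_nonneg ht0 ha
  have h2 := mul_nonneg ht0 hb
  have h3 := mul_nonneg (sub_nonneg.2 ht1) ha
  have h4 := mul_nonneg (sub_nonneg.2 ht1) hb
  rw [key, abs_le]
  constructor <;> linarith [hA.1, hA.2, hB.1, hB.2]
end

section
/- Let ξ > 0, let n be a positive integer, and set L := n·ξ/2 and Ξ := {−L + j·ξ : j = 0,…,n}. Let h : ℝ → ℝ be a convex, twice differentiable function with h''(x) ≥ κ for all x ∈ [−L, L], where κ > 0, and suppose h attains its global minimum over ℝ at some point x* ∈ [−L, L]. Let c̲ be the largest element of Ξ with c̲ ≤ x* and c̄ the smallest element of Ξ with c̄ ≥ x*. Then for every z ∈ Ξ with z ∉ {c̲, c̄}, it holds that h(z) ≥ min(h(c̲), h(c̄)) + κ·ξ²/2. -/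
theorem aux_tangent (g : ℝ → ℝ) (s : Set ℝ) (hg : ConvexOn ℝ s g) (c z d : ℝ) (hc : c ∈ s)
    (hz : z ∈ s) (hd : HasDerivAt g d c) : g c + d * (z - c) ≤ g z := by
  rcases lt_trichotomy c z with h | h | h
  · have := hg.le_slope_of_hasDerivAt hc hz h hd
    rw [slope_def_field, le_div_iff₀ (by linarith)] at this
    linarith
  · subst h; simp
  · have := hg.slope_le_of_hasDerivAt hz hc h hd
    rw [slope_def_field, div_le_iff₀ (by linarith)] at this
    linarith

theorem aux_strong (L κ : ℝ) (h h' h'' : ℝ → ℝ)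
    (hd1 : ∀ x, HasDerivAt h (h' x) x) (hd2 : ∀ x, HasDerivAt h' (h'' x) x)
    (hκle : ∀ x ∈ Set.Icc (-L) L, κ ≤ h'' x) (c z : ℝ) (hc : c ∈ Set.Icc (-L) L)
    (hz : z ∈ Set.Icc (-L) L) : h c + h' c * (z - c) + κ * (z - c) ^ 2 / 2 ≤ h z := by
  have e1 : ∀ x, HasDerivAt (fun x => h x - κ * x ^ 2 / 2) (h' x - κ * x) x := by
    intro x
    have := (hd1 x).sub (((hasDerivAt_pow 2 x).const_mul κ).div_const 2)
    refine this.congr_deriv ?_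
    push_cast; ring
  have e2 : ∀ x, HasDerivAt (fun x => h' x - κ * x) (h'' x - κ) x := by
    intro x
    have := (hd2 x).sub ((hasDerivAt_id x).const_mul κ)
    refine this.congr_deriv ?_
    ring
  have hg : ConvexOn ℝ (Set.Icc (-L) L) (fun x => h x - κ * x ^ 2 / 2) := by
    refine convexOn_of_hasDerivWithinAt2_nonneg (convex_Icc _ _)
      (fun x _ => (e1 x).continuousAt.continuousWithinAt)
      (fun x _ => (e1 x).hasDerivWithinAt) (fun x _ => (e2 x).hasDerivWithinAt) ?_
    intro x hx
    have := hκle x (interior_subset hx)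
    linarith
  have := aux_tangent _ _ hg c z _ hc hz (e1 c)
  nlinarith

/-- On the grid `Ξ = {−L + j·ξ : j = 0,…,n}` with `L = n·ξ/2`, a
convex twice-differentiable function `h` with `h'' ≥ κ > 0` on `[−L,L]` whose global
minimizer `x*` lies in `[−L,L]` satisfies, for every grid point `z` other than the
two grid points `c̲ ≤ x* ≤ c̄` bracketing `x*`, `h(z) ≥ min(h(c̲),h(c̄)) + κ·ξ²/2`. -/
theorem stmt_12 (ξ : ℝ) (hξ : 0 < ξ) (n : ℕ) (hn : 0 < n)
    (L : ℝ) (hL : L = (n : ℝ) * ξ / 2)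
    (Ξ : Finset ℝ) (hΞ : Ξ = (Finset.range (n + 1)).image (fun j : ℕ => -L + (j : ℝ) * ξ))
    (h h' h'' : ℝ → ℝ)
    (hconv : ConvexOn ℝ Set.univ h)
    (hd1 : ∀ x, HasDerivAt h (h' x) x) (hd2 : ∀ x, HasDerivAt h' (h'' x) x)
    (κ : ℝ) (hκ : 0 < κ) (hκle : ∀ x ∈ Set.Icc (-L) L, κ ≤ h'' x)
    (xstar : ℝ) (hx : xstar ∈ Set.Icc (-L) L) (hmin : ∀ x : ℝ, h xstar ≤ h x)
    (cund cbar : ℝ)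
    (hcund : cund ∈ Ξ ∧ cund ≤ xstar ∧ ∀ z ∈ Ξ, z ≤ xstar → z ≤ cund)
    (hcbar : cbar ∈ Ξ ∧ xstar ≤ cbar ∧ ∀ z ∈ Ξ, xstar ≤ z → cbar ≤ z) :
    ∀ z ∈ Ξ, z ∉ ({cund, cbar} : Set ℝ) →
      min (h cund) (h cbar) + κ * ξ ^ 2 / 2 ≤ h z := by
  have hx0 : h' xstar = 0 :=
    IsLocalMin.hasDerivAt_eq_zero (Filter.Eventually.of_forall hmin) (hd1 xstar)
  have hIcc : ∀ z ∈ Ξ, z ∈ Set.Icc (-L) L := by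
    intro z hz
    rw [hΞ] at hz
    simp only [Finset.mem_image, Finset.mem_range] at hz
    obtain ⟨j, hj, rfl⟩ := hz
    have hj' : (j : ℝ) ≤ n := by exact_mod_cast Nat.lt_succ_iff.mp hj
    have h1 : (j : ℝ) * ξ ≤ n * ξ := by gcongr
    have h0 : 0 ≤ (j : ℝ) * ξ := by positivity
    constructor <;> linarith
  have hgap : ∀ z ∈ Ξ, ∀ w ∈ Ξ, w < z → ξ ≤ z - w := by
    intro z hz w hw hlt
    rw [hΞ] at hz hw
    simp only [Finset.mem_image, Finset.mem_range] at hz hw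
    obtain ⟨j, hj, rfl⟩ := hz
    obtain ⟨k, hk, rfl⟩ := hw
    have hlt' : (k : ℝ) < j := by
      by_contra! hcon
      have : (j : ℝ) * ξ ≤ k * ξ := by gcongr
      linarith
    have h1 : (k : ℝ) + 1 ≤ j := by exact_mod_cast hlt'
    have h2 : ((k : ℝ) + 1) * ξ ≤ j * ξ := by gcongr
    linarith
  have hsign : ∀ c, 0 ≤ h' c * (c - xstar) := by
    intro c
    have := aux_tangent h _ hconv c xstar _ (Set.mem_univ _) (Set.mem_univ _) (hd1 c)
    have := hmin c
    linarith
  intro z hz hzn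
  simp only [Set.mem_insert_iff, Set.mem_singleton_iff, not_or] at hzn
  obtain ⟨hz1, hz2⟩ := hzn
  rcases le_total z xstar with hle | hle
  · have hlt := lt_of_le_of_ne (hcund.2.2 z hz hle) hz1
    have hg := hgap _ hcund.1 _ hz hlt
    have hs := aux_strong L κ h h' h'' hd1 hd2 hκle cund z (hIcc _ hcund.1) (hIcc _ hz)
    have hd : h' cund ≤ 0 := by
      rcases eq_or_lt_of_le hcund.2.1 with he | he
      · rw [he, hx0]
      · by_contra! hcon
        have := hsign cund
        nlinarith
    have h1 : 0 ≤ h' cund * (z - cund) := mul_nonneg_of_nonpos_of_nonpos hd (by linarith)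
    have h2 : ξ ^ 2 ≤ (z - cund) ^ 2 := by nlinarith
    have h3 := mul_le_mul_of_nonneg_left h2 hκ.le
    have := min_le_left (h cund) (h cbar)
    linarith
  · have hlt := lt_of_le_of_ne (hcbar.2.2 z hz hle) (Ne.symm hz2)
    have hg := hgap _ hz _ hcbar.1 hlt
    have hs := aux_strong L κ h h' h'' hd1 hd2 hκle cbar z (hIcc _ hcbar.1) (hIcc _ hz)
    have hd : 0 ≤ h' cbar := by
      rcases eq_or_lt_of_le hcbar.2.1 with he | he
      · rw [← he, hx0]
      · by_contra! hcon
        have := hsign cbar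
        nlinarith
    have h1 : 0 ≤ h' cbar * (z - cbar) := mul_nonneg hd (by linarith)
    have h2 : ξ ^ 2 ≤ (z - cbar) ^ 2 := by nlinarith
    have h3 := mul_le_mul_of_nonneg_left h2 hκ.le
    have := min_le_right (h cund) (h cbar)
    linarith
end
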